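/- arXiv:2211.15232 — 4 statements merged into one kernel-verified Lean document; each statement's English description precedes it below -/
import Mathlib

section
/- Assume d = 1, μ has finite second moment, and σ is X-controlled. Fix α > 0 and, for x ∈ X, let S_n(b,x) = Σ_{j=3}^{n} X^{(j)}(b_j, b_{j−1}⋯b_1·x) denote the truncated recentered sums with truncation parameter α. Then for every ε > 0 there exists n₀ ≥ 3 such that for every n ≥ n₀, every x ∈ X and every 0 ≤ k ≤ n, β-almost surely the conditional probability β(|S_n(·,x) − S_k(·,x)| ≤ ε a_n | 𝓑_k) is at least 1/2, where a_n = √(2 n log log n). -/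
open MeasureTheory Filter Topology
open scoped ENNReal NNReal

noncomputable section

/-- The group element b_n ⋯ b_1, where b_i is coordinate i - 1 of b. -/
def prodRev {G : Type*} [Monoid G] (b : ℕ → G) : ℕ → G
  | 0 => 1
  | n + 1 => b n * prodRev b n

/-- The σ-algebra on ℕ → G generated by the first k coordinates. -/
def coordSA (G : Type*) [MeasurableSpace G] (k : ℕ) : MeasurableSpace (ℕ → G) :=
  MeasurableSpace.comap (fun b (i : Fin k) => b i) MeasurableSpace.pi

/-- The truncated increment X₁⁽ʲ⁾(g, y) = σ(g, y)·1_{|g| ≤ α √(j / log log j)}. -/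
def truncInc {G X : Type*} (σ : G → X → ℝ) (N : G → ℝ) (α : ℝ) (j : ℕ)
    (g : G) (y : X) : ℝ :=
  if N g ≤ α * Real.sqrt (j / Real.log (Real.log j)) then σ g y else 0

/-- The recentered truncated increment X⁽ʲ⁾(g, y) = X₁⁽ʲ⁾(g, y) − ∫ X₁⁽ʲ⁾(·, y) dμ. -/
def truncIncC {G X : Type*} [MeasurableSpace G] (σ : G → X → ℝ) (N : G → ℝ)
    (μ : Measure G) (α : ℝ) (j : ℕ) (g : G) (y : X) : ℝ :=
  truncInc σ N α j g y - ∫ g2, truncInc σ N α j g2 y ∂μ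

/-- The truncated recentered sum S_n(b, x) = ∑_{j=3}^n X⁽ʲ⁾(b_j, b_{j-1} ⋯ b_1 · x). -/
def truncSum {G X : Type*} [Monoid G] [MulAction G X] [MeasurableSpace G]
    (σ : G → X → ℝ) (N : G → ℝ) (μ : Measure G) (α : ℝ) (x : X)
    (n : ℕ) (b : ℕ → G) : ℝ :=
  ∑ j ∈ Finset.Icc 3 n, truncIncC σ N μ α j (b (j - 1)) (prodRev b (j - 1) • x)

/-- The normalisation a_n = √(2 n log log n). -/
def lilNorm (n : ℕ) : ℝ := Real.sqrt (2 * n * Real.log (Real.log n))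


/-- The n-th convolution power of μ: the law of b_n ⋯ b_1 for i.i.d. b_i of law μ. -/
def convPow {G : Type*} [Monoid G] [MeasurableSpace G] (μ : Measure G) : ℕ → Measure G
  | 0 => Measure.dirac 1
  | n + 1 => (μ.prod (convPow μ n)).map fun p => p.1 * p.2

section Helpers

variable {G : Type*} [Group G] [MeasurableSpace G] [MeasurableMul₂ G]
  {X : Type*} [MetricSpace X] [CompactSpace X] [MeasurableSpace X] [BorelSpace X]
  [MulAction G X]

lemma aux_coordSA_le (k : ℕ) : coordSA G k ≤ (MeasurableSpace.pi : MeasurableSpace (ℕ → G)) := by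
  unfold coordSA
  rw [← measurable_iff_comap_le]
  exact measurable_pi_iff.2 fun i => measurable_pi_apply _

lemma aux_coord_meas {i k : ℕ} (h : i < k) :
    Measurable[coordSA G k] (fun b : ℕ → G => b i) := by
  have h1 : Measurable[coordSA G k] (fun (b : ℕ → G) (i : Fin k) => b i) :=
    comap_measurable _
  exact (measurable_pi_apply (⟨i, h⟩ : Fin k)).comp h1

lemma aux_coordSA_mono {k l : ℕ} (h : k ≤ l) : coordSA G k ≤ coordSA G l := by
  have h1 : Measurable[coordSA G l] (fun (b : ℕ → G) (i : Fin k) => b i) := by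
    refine @measurable_pi_lambda _ _ _ (coordSA G l) _ _ fun i => ?_
    exact aux_coord_meas (lt_of_lt_of_le i.2 h)
  exact measurable_iff_comap_le.1 h1

lemma aux_prodRev_meas (n : ℕ) :
    Measurable[coordSA G n] (fun b : ℕ → G => prodRev b n) := by
  induction n with
  | zero => exact @measurable_const _ _ _ (coordSA G 0) _
  | succ n ih =>
    have h1 : Measurable[coordSA G (n+1)] (fun b : ℕ → G => prodRev b n) :=
      ih.mono (aux_coordSA_mono (Nat.le_succ n)) le_rfl
    have h2 : Measurable[coordSA G (n+1)] (fun b : ℕ → G => b n) :=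
      aux_coord_meas (Nat.lt_succ_self n)
    exact h2.mul h1

lemma aux_orbit_meas (hact : Measurable fun p : G × X => p.1 • p.2) (x : X) (n : ℕ) :
    Measurable[coordSA G n] (fun b : ℕ → G => prodRev b n • x) := by
  have h : Measurable (fun g : G => g • x) := hact.comp (measurable_id.prodMk measurable_const)
  exact h.comp (aux_prodRev_meas n)

lemma aux_map (μ : Measure G) [IsProbabilityMeasure μ] (β : Measure (ℕ → G))
    (hβ : ∀ n : ℕ, β.map (fun b (i : Fin n) => b i) = Measure.pi fun _ : Fin n => μ) (n : ℕ) :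
    β.map (fun b => (b n, fun i : Fin n => b i)) = μ.prod (Measure.pi fun _ : Fin n => μ) := by
  have h := (measurePreserving_piFinSuccAbove (fun _ : Fin (n+1) => μ) (Fin.last n)).map_eq
  have hr : Measurable (fun (b : ℕ → G) (i : Fin (n+1)) => b i) :=
    measurable_pi_iff.2 fun i => measurable_pi_apply _
  rw [← hβ (n+1), Measure.map_map (MeasurableEquiv.measurable _) hr] at h
  rw [← h]
  congr 1
  funext b
  refine Prod.ext ?_ ?_
  · rfl
  · funext i
    simp [MeasurableEquiv.piFinSuccAbove, Fin.insertNthEquiv, Fin.init]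

lemma aux_key (hact : Measurable fun p : G × X => p.1 • p.2)
    (μ : Measure G) [IsProbabilityMeasure μ] (β : Measure (ℕ → G)) [IsProbabilityMeasure β]
    (hβ : ∀ n : ℕ, β.map (fun b (i : Fin n) => b i) = Measure.pi fun _ : Fin n => μ) (n : ℕ)
    (x : X) (F : (ℕ → G) → ℝ) (hF : Measurable[coordSA G n] F) (C : ℝ) (hC : ∀ b, |F b| ≤ C)
    (H : G × X → ℝ) (hH : Measurable H) (K : ℝ) (hK : ∀ p, |H p| ≤ K) :
    ∫ b, F b * H (b n, prodRev b n • x) ∂β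
      = ∫ b, F b * (∫ g, H (g, prodRev b n • x) ∂μ) ∂β := by
  have : Nonempty X := ⟨x⟩
  obtain ⟨F', hF', hFF⟩ := Measurable.exists_eq_measurable_comp (f := fun (b : ℕ → G) (i : Fin n) => b i) hF
  have hz := aux_orbit_meas hact x n
  obtain ⟨z, hz', hzz⟩ := Measurable.exists_eq_measurable_comp (f := fun (b : ℕ → G) (i : Fin n) => b i) hz
  have hzb : ∀ b : ℕ → G, prodRev b n • x = z (fun i : Fin n => b i) := fun b => congrFun hzz b
  have hFb : ∀ b : ℕ → G, F b = F' (fun i : Fin n => b i) := fun b => congrFun hFF b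
  have hF'C : ∀ u : Fin n → G, |F' u| ≤ C := by
    intro u
    have := hC (fun i => if h : i < n then u ⟨i, h⟩ else 1)
    rw [hFb] at this
    simpa using this
  have hr : Measurable (fun (b : ℕ → G) (i : Fin n) => b i) :=
    measurable_pi_iff.2 fun i => measurable_pi_apply _
  have hΦ : Measurable (fun p : G × (Fin n → G) => F' p.2 * H (p.1, z p.2)) :=
    (hF'.comp measurable_snd).mul (hH.comp (measurable_fst.prodMk (hz'.comp measurable_snd)))
  have hI : StronglyMeasurable (fun y : X => ∫ g, H (g, y) ∂μ) :=
    hH.stronglyMeasurable.integral_prod_left'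
  simp_rw [hzb, hFb]
  have e1 : ∫ b, F' (fun i : Fin n => b i) * H (b n, z (fun i : Fin n => b i)) ∂β
      = ∫ p, F' p.2 * H (p.1, z p.2) ∂(β.map (fun b => (b n, fun i : Fin n => b i))) :=
    (integral_map ((measurable_pi_apply n).prodMk hr).aemeasurable
      hΦ.aestronglyMeasurable).symm
  have e2 : ∫ b, F' (fun i : Fin n => b i) * (∫ g, H (g, z (fun i : Fin n => b i)) ∂μ) ∂β
      = ∫ u, F' u * (∫ g, H (g, z u) ∂μ) ∂(β.map (fun b (i : Fin n) => b i)) :=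
    (integral_map hr.aemeasurable
      (hF'.mul (hI.measurable.comp hz')).aestronglyMeasurable).symm
  rw [e1, e2, aux_map μ β hβ n, hβ n, integral_prod_symm]
  · simp_rw [integral_const_mul]
  · refine Integrable.of_bound hΦ.aestronglyMeasurable (C * K) (ae_of_all _ fun p => ?_)
    rw [Real.norm_eq_abs, abs_mul]
    exact mul_le_mul (hF'C _) (hK _) (abs_nonneg _) ((abs_nonneg _).trans (hF'C p.2))

/-- partial sums of martingale increments -/
def auxT (h : ℕ → G × X → ℝ) (x : X) (k n : ℕ) (b : ℕ → G) : ℝ :=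
  ∑ i ∈ Finset.Ico k n, h i (b i, prodRev b i • x)

lemma auxT_meas (hact : Measurable fun p : G × X => p.1 • p.2)
    (h : ℕ → G × X → ℝ) (hm : ∀ i, Measurable (h i)) (x : X) (k n : ℕ) :
    Measurable[coordSA G n] (auxT h x k n) := by
  unfold auxT
  refine @Finset.measurable_fun_sum _ _ _ _ _ _ (coordSA G n) _ _ fun i hi => ?_
  have hi' := (Finset.mem_Ico.1 hi).2
  refine (hm i).comp ?_
  have h1 : Measurable[coordSA G n] (fun b : ℕ → G => prodRev b i • x) :=
    (aux_orbit_meas hact x i).mono (aux_coordSA_mono hi'.le) le_rfl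
  exact (aux_coord_meas hi').prodMk h1

lemma auxT_bdd (h : ℕ → G × X → ℝ) (hb : ∀ i, ∃ C, ∀ p, |h i p| ≤ C) (x : X) (k n : ℕ) :
    ∃ C, ∀ b : ℕ → G, |auxT h x k n b| ≤ C := by
  choose C hC using hb
  exact ⟨∑ i ∈ Finset.Ico k n, C i, fun b => (Finset.abs_sum_le_sum_abs _ _).trans
    (Finset.sum_le_sum fun i _ => hC i _)⟩

lemma auxT_var (hact : Measurable fun p : G × X => p.1 • p.2)
    (μ : Measure G) [IsProbabilityMeasure μ] (β : Measure (ℕ → G)) [IsProbabilityMeasure β]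
    (hβ : ∀ n : ℕ, β.map (fun b (i : Fin n) => b i) = Measure.pi fun _ : Fin n => μ)
    (h : ℕ → G × X → ℝ) (hm : ∀ i, Measurable (h i)) (hb : ∀ i, ∃ C, ∀ p, |h i p| ≤ C)
    (h0 : ∀ i y, ∫ g, h i (g, y) ∂μ = 0) (M : ℝ)
    (hM : ∀ i y, ∫ g, (h i (g, y)) ^ 2 ∂μ ≤ M) (x : X) (k : ℕ)
    (D : Set (ℕ → G)) (hD : MeasurableSet[coordSA G k] D) (n : ℕ) (hkn : k ≤ n) :
    ∫ b, D.indicator (fun _ => (1:ℝ)) b * (auxT h x k n b) ^ 2 ∂β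
      ≤ ((n : ℝ) - k) * M * β.real D := by
  have hD0 : MeasurableSet D := aux_coordSA_le k _ hD
  induction n, hkn using Nat.le_induction with
  | base => simp [auxT]
  | succ n hkn ih =>
    set I : (ℕ → G) → ℝ := D.indicator (fun _ => (1:ℝ)) with hI
    have hI1 : ∀ b, |I b| ≤ 1 := by
      intro b; rw [hI]; by_cases hb : b ∈ D <;> simp [hb]
    have hI0 : ∀ b, 0 ≤ I b := fun b => Set.indicator_nonneg (fun _ _ => zero_le_one) b
    have hDn : MeasurableSet[coordSA G n] D := aux_coordSA_mono hkn _ hD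
    have hImk : Measurable[coordSA G n] I :=
      (@measurable_const _ _ _ (coordSA G n) (1:ℝ)).indicator hDn
    have hIm : Measurable I := hImk.mono (aux_coordSA_le n) le_rfl
    have hTk := auxT_meas hact h hm x k n
    have hT : Measurable (auxT h x k n) := hTk.mono (aux_coordSA_le n) le_rfl
    obtain ⟨C, hC⟩ := auxT_bdd h hb x k n
    obtain ⟨K, hK⟩ := hb n
    have hC0 : 0 ≤ C := (abs_nonneg _).trans (hC (fun _ => 1))
    have hK0 : 0 ≤ K := (abs_nonneg _).trans (hK (1, x))
    have hz : Measurable (fun b : ℕ → G => prodRev b n • x) :=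
      (aux_orbit_meas hact x n).mono (aux_coordSA_le n) le_rfl
    have hY : Measurable (fun b : ℕ → G => h n (b n, prodRev b n • x)) :=
      (hm n).comp ((measurable_pi_apply n).prodMk hz)
    have hsucc : ∀ b, auxT h x k (n+1) b = auxT h x k n b + h n (b n, prodRev b n • x) := by
      intro b; unfold auxT; rw [Finset.sum_Ico_succ_top hkn]
    have hFC : ∀ b, |I b * (2 * auxT h x k n b)| ≤ 2 * C := by
      intro b
      rw [abs_mul, abs_mul, abs_two]
      have := hC b
      nlinarith [hI1 b, abs_nonneg (I b), abs_nonneg (auxT h x k n b)]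
    have hH2 : ∀ p : G × X, |(h n p)^2| ≤ K^2 := by
      intro p; rw [abs_pow]; exact pow_le_pow_left₀ (abs_nonneg _) (hK p) 2
    have k1 := aux_key hact μ β hβ n x (fun b => I b * (2 * auxT h x k n b))
      (hImk.mul (hTk.const_mul 2)) (2 * C) hFC (h n) (hm n) K hK
    have k2 := aux_key hact μ β hβ n x I hImk 1 hI1 (fun p => (h n p)^2) ((hm n).pow_const 2)
      (K^2) hH2
    simp only [h0, mul_zero, integral_zero] at k1
    have i1 : Integrable (fun b => I b * (auxT h x k n b)^2) β := by
      refine Integrable.of_bound (hIm.mul (hT.pow_const 2)).aestronglyMeasurable (C^2)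
        (ae_of_all _ fun b => ?_)
      rw [Real.norm_eq_abs, abs_mul, abs_pow]
      have := pow_le_pow_left₀ (abs_nonneg _) (hC b) 2
      nlinarith [hI1 b, abs_nonneg (I b), sq_nonneg C]
    have i2 : Integrable (fun b => I b * (2 * auxT h x k n b) * h n (b n, prodRev b n • x)) β := by
      refine Integrable.of_bound ((hIm.mul (hT.const_mul 2)).mul hY).aestronglyMeasurable
        (2 * C * K) (ae_of_all _ fun b => ?_)
      rw [Real.norm_eq_abs, abs_mul]
      exact mul_le_mul (hFC b) (hK _) (abs_nonneg _) (by positivity)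
    have i3 : Integrable (fun b => I b * (h n (b n, prodRev b n • x))^2) β := by
      refine Integrable.of_bound (hIm.mul (hY.pow_const 2)).aestronglyMeasurable
        (1 * K^2) (ae_of_all _ fun b => ?_)
      rw [Real.norm_eq_abs, abs_mul]
      exact mul_le_mul (hI1 b) (hH2 _) (abs_nonneg _) zero_le_one
    have hq : StronglyMeasurable (fun y : X => ∫ g, (h n (g, y))^2 ∂μ) :=
      ((hm n).pow_const 2).stronglyMeasurable.integral_prod_left'
    have hq0 : ∀ y, 0 ≤ ∫ g, (h n (g, y))^2 ∂μ := fun y => integral_nonneg fun g => sq_nonneg _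
    have i4 : Integrable (fun b => I b * M) β :=
      (Integrable.of_bound hIm.aestronglyMeasurable 1 (ae_of_all _ hI1)).mul_const M
    have i5 : Integrable (fun b => I b * ∫ g, (h n (g, prodRev b n • x))^2 ∂μ) β := by
      refine Integrable.of_bound (hIm.mul (hq.measurable.comp hz)).aestronglyMeasurable
        (1 * M) (ae_of_all _ fun b => ?_)
      rw [Real.norm_eq_abs, abs_mul, abs_of_nonneg (hq0 _)]
      exact mul_le_mul (hI1 b) (hM _ _) (hq0 _) zero_le_one
    have k3 : ∫ b, I b * ∫ g, (h n (g, prodRev b n • x))^2 ∂μ ∂β ≤ M * β.real D := by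
      refine (integral_mono i5 i4 fun b => mul_le_mul_of_nonneg_left (hM n _) (hI0 b)).trans ?_
      rw [integral_mul_const, hI, integral_indicator_const _ hD0]
      simp [mul_comm]
    have e : ∫ b, I b * (auxT h x k (n+1) b) ^ 2 ∂β
        = ∫ b, I b * (auxT h x k n b)^2 ∂β
          + ∫ b, I b * (2 * auxT h x k n b) * h n (b n, prodRev b n • x) ∂β
          + ∫ b, I b * (h n (b n, prodRev b n • x))^2 ∂β := by
      have i12 : Integrable (fun b => I b * (auxT h x k n b)^2
          + I b * (2 * auxT h x k n b) * h n (b n, prodRev b n • x)) β := i1.add i2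
      rw [← integral_add i1 i2, ← integral_add i12 i3]
      congr 1; funext b; simp only [hsucc]; ring
    rw [e, k1, k2]
    push_cast
    linarith

lemma aux_main (hact : Measurable fun p : G × X => p.1 • p.2)
    (μ : Measure G) [IsProbabilityMeasure μ] (β : Measure (ℕ → G)) [IsProbabilityMeasure β]
    (hβ : ∀ n : ℕ, β.map (fun b (i : Fin n) => b i) = Measure.pi fun _ : Fin n => μ)
    (h : ℕ → G × X → ℝ) (hm : ∀ i, Measurable (h i)) (hb : ∀ i, ∃ C, ∀ p, |h i p| ≤ C)
    (h0 : ∀ i y, ∫ g, h i (g, y) ∂μ = 0) (M : ℝ) (hM0 : 0 ≤ M)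
    (hM : ∀ i y, ∫ g, (h i (g, y)) ^ 2 ∂μ ≤ M) (x : X) (k : ℕ)
    (n : ℕ) (hkn : k ≤ n) (a : ℝ) (ha : 0 < a) (hna : n * M ≤ a ^ 2 / 2) :
    ∀ᵐ b ∂β, (1 : ℝ) / 2 ≤
        (β[Set.indicator {b2 | |auxT h x k n b2| ≤ a} (fun _ => (1 : ℝ)) | coordSA G k]) b := by
  have hT : Measurable (auxT h x k n) :=
    (auxT_meas hact h hm x k n).mono (aux_coordSA_le n) le_rfl
  obtain ⟨C, hC⟩ := auxT_bdd h hb x k n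
  set A : Set (ℕ → G) := {b2 | |auxT h x k n b2| ≤ a} with hA
  have hAm : MeasurableSet A := measurableSet_le hT.abs measurable_const
  set f : (ℕ → G) → ℝ := A.indicator (fun _ => (1:ℝ)) with hf
  have hfi : Integrable f β := (integrable_const (1:ℝ)).indicator hAm
  have hle := aux_coordSA_le (G := G) k
  suffices hs : (fun _ => (1:ℝ)/2) ≤ᵐ[β.trim hle] β[f | coordSA G k] by
    exact ae_le_of_ae_le_trim hs
  refine @ae_le_of_forall_setIntegral_le _ (coordSA G k) _ _ _ ?_ ?_ ?_
  · exact integrable_const _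
  · exact integrable_condExp.trim hle stronglyMeasurable_condExp
  intro D hD _
  have hD0 : MeasurableSet D := hle _ hD
  rw [← setIntegral_trim hle stronglyMeasurable_condExp hD,
    ← setIntegral_trim hle (@stronglyMeasurable_const _ _ (coordSA G k) _ _) hD,
    setIntegral_condExp hle hfi hD]
  have hv := auxT_var hact μ β hβ h hm hb h0 M hM x k D hD n hkn
  have hv' : ∫ b in D, (auxT h x k n b)^2 ∂β ≤ ((n : ℝ) - k) * M * β.real D := by
    refine le_trans (le_of_eq ?_) hv
    rw [← integral_indicator hD0]
    congr 1; funext b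
    by_cases hbD : b ∈ D <;> simp [hbD]
  have iT : Integrable (fun b => (auxT h x k n b)^2) β := by
    refine Integrable.of_bound (hT.pow_const 2).aestronglyMeasurable (C^2) (ae_of_all _ fun b => ?_)
    rw [Real.norm_eq_abs, abs_pow]
    exact pow_le_pow_left₀ (abs_nonneg _) (hC b) 2
  have iT' : Integrable (fun b => (auxT h x k n b)^2 / a^2) β := iT.div_const _
  have hpt : ∀ b, 1 - (auxT h x k n b)^2 / a^2 ≤ f b := by
    intro b
    by_cases hbA : b ∈ A
    · simp only [hf, Set.indicator_of_mem hbA]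
      have : 0 ≤ (auxT h x k n b)^2 / a^2 := by positivity
      linarith
    · simp only [hf, Set.indicator_of_notMem hbA]
      have h1 : a < |auxT h x k n b| := by simpa [hA] using hbA
      have : 1 ≤ (auxT h x k n b)^2 / a^2 := by
        rw [le_div_iff₀ (by positivity), one_mul, ← sq_abs (auxT h x k n b)]
        exact pow_le_pow_left₀ ha.le h1.le 2
      linarith
  have step : ∫ b in D, (1 - (auxT h x k n b)^2 / a^2) ∂β ≤ ∫ b in D, f b ∂β :=
    integral_mono ((integrable_const (1:ℝ)).sub iT').integrableOn hfi.integrableOn hpt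
  refine le_trans ?_ step
  rw [integral_sub (integrable_const (1:ℝ)).integrableOn iT'.integrableOn,
    setIntegral_const, smul_eq_mul, integral_div]
  simp only [smul_eq_mul, setIntegral_const]
  have hr : 0 ≤ β.real D := measureReal_nonneg
  have hk0 : (0:ℝ) ≤ k := Nat.cast_nonneg k
  have : (∫ b in D, (auxT h x k n b)^2 ∂β) / a^2 ≤ β.real D / 2 := by
    rw [div_le_iff₀ (by positivity)]
    have : ((n : ℝ) - k) * M ≤ a^2/2 := by nlinarith
    nlinarith
  linarith

end Helpers

/-- conditional anti-concentration of the truncated recentered sums. -/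
theorem conditional_anticoncentration
    {G : Type*} [Group G] [MeasurableSpace G] [MeasurableMul₂ G]
    {X : Type*} [MetricSpace X] [CompactSpace X] [MeasurableSpace X] [BorelSpace X]
    [MulAction G X] (hact : Measurable fun p : G × X => p.1 • p.2)
    (σ : G → X → ℝ)
    (hσmeas : Measurable fun p : G × X => σ p.1 p.2)
    (hcoc : ∀ g₁ g₂ : G, ∀ x : X, σ (g₂ * g₁) x = σ g₂ (g₁ • x) + σ g₁ x)
    (N : G → ℝ) (hN0 : ∀ g, 0 ≤ N g) (hNsub : ∀ g h : G, N (g * h) ≤ N g + N h)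
    (hNσ : ∀ g x, |σ g x| ≤ N g)
    (μ : Measure G) [IsProbabilityMeasure μ]
    (hmom1 : Integrable N μ)
    (hdrift : ∀ x, ∫ g, σ g x ∂μ = 0)
    (hmom2 : Integrable (fun g => N g ^ 2) μ)
    (hcont : ∀ g, Continuous (σ g))
    (hXctrl : ∀ ε > (0 : ℝ), ∃ R > (0 : ℝ), ∀ n : ℕ, 1 ≤ n → ∀ x y : X,
      ENNReal.ofReal (1 - ε) ≤ convPow μ n {g | |σ g x - σ g y| ≤ R})
    (β : Measure (ℕ → G)) [IsProbabilityMeasure β]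
    (hβ : ∀ n : ℕ, β.map (fun b (i : Fin n) => b i) = Measure.pi fun _ : Fin n => μ)
    (α : ℝ) (hα : 0 < α) :
    ∀ ε > (0 : ℝ), ∃ n₀ : ℕ, 3 ≤ n₀ ∧ ∀ n : ℕ, n₀ ≤ n → ∀ x : X, ∀ k : ℕ, k ≤ n →
      ∀ᵐ b ∂β, (1 : ℝ) / 2 ≤
        (β[Set.indicator
            {b2 | |truncSum σ N μ α x n b2 - truncSum σ N μ α x k b2| ≤ ε * lilNorm n}
            (fun _ => (1 : ℝ)) | coordSA G k]) b := by
  intro ε hε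
  set M : ℝ := ∫ g, N g ^ 2 ∂μ with hMdef
  have hM0 : 0 ≤ M := integral_nonneg fun g => sq_nonneg _
  obtain ⟨N', hN'm, hNN'⟩ := hmom1.aestronglyMeasurable.aemeasurable
  set A : Set G := (toMeasurable μ {g | ¬ N g = N' g})ᶜ with hAdef
  have hAm : MeasurableSet A := (measurableSet_toMeasurable _ _).compl
  have hAN : ∀ g ∈ A, N g = N' g := by
    intro g hg
    by_contra hne
    exact hg (subset_toMeasurable μ _ hne)
  have hAae : ∀ᵐ g ∂μ, g ∈ A := by
    rw [ae_iff]
    have : {g | ¬ g ∈ A} = toMeasurable μ {g | ¬ N g = N' g} := by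
      ext g; simp [hAdef]
    rw [this, measure_toMeasurable]
    exact ae_iff.1 hNN'
  set c : ℕ → ℝ := fun j => α * Real.sqrt (j / Real.log (Real.log j)) with hc
  have hc0 : ∀ j, 0 ≤ c j := fun j => mul_nonneg hα.le (Real.sqrt_nonneg _)
  set f : ℕ → G × X → ℝ := fun j p =>
    ({p : G × X | p.1 ∈ A ∧ N' p.1 ≤ c j}).indicator (fun p => σ p.1 p.2) p with hf
  have hfm : ∀ j, Measurable (f j) := fun j =>
    hσmeas.indicator ((measurable_fst hAm).inter
      (measurableSet_le (hN'm.comp measurable_fst) measurable_const))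
  have hfN : ∀ j p, |f j p| ≤ N p.1 := by
    intro j p
    by_cases hp : p ∈ {p : G × X | p.1 ∈ A ∧ N' p.1 ≤ c j}
    · simp only [hf, Set.indicator_of_mem hp]; exact hNσ _ _
    · simp only [hf, Set.indicator_of_notMem hp, abs_zero]; exact hN0 _
  have hfc : ∀ j p, |f j p| ≤ c j := by
    intro j p
    by_cases hp : p ∈ {p : G × X | p.1 ∈ A ∧ N' p.1 ≤ c j}
    · simp only [hf, Set.indicator_of_mem hp]
      refine (hNσ _ _).trans ?_
      rw [hAN _ hp.1]; exact hp.2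
    · simp only [hf, Set.indicator_of_notMem hp, abs_zero]; exact hc0 j
  have hft : ∀ j g y, g ∈ A → truncInc σ N α j g y = f j (g, y) := by
    intro j g y hg
    simp only [truncInc, hf, Set.indicator, Set.mem_setOf_eq, hAN g hg, hg, true_and, hc]
  have hfI : ∀ j y, ∫ g, truncInc σ N α j g y ∂μ = ∫ g, f j (g, y) ∂μ := by
    intro j y
    refine integral_congr_ae ?_
    filter_upwards [hAae] with g hg using hft j g y hg
  have hfint : ∀ j y, Integrable (fun g => f j (g, y)) μ := fun j y =>
    Integrable.of_bound ((hfm j).comp (measurable_id.prodMk measurable_const)).aestronglyMeasurable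
      (c j) (ae_of_all _ fun g => hfc j _)
  have hfIb : ∀ j y, |∫ g, f j (g, y) ∂μ| ≤ c j := by
    intro j y
    have := norm_integral_le_of_norm_le_const (μ := μ) (f := fun g => f j (g, y)) (C := c j)
      (ae_of_all _ fun g => hfc j _)
    simpa using this
  set h : ℕ → G × X → ℝ := fun i p =>
    if 2 ≤ i then f (i+1) p - ∫ g, f (i+1) (g, p.2) ∂μ else 0 with hh
  have hhm : ∀ i, Measurable (h i) := by
    intro i
    by_cases hi : 2 ≤ i
    · simp only [hh, hi, if_true]
      have : StronglyMeasurable (fun y : X => ∫ g, f (i+1) (g, y) ∂μ) :=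
        (hfm (i+1)).stronglyMeasurable.integral_prod_left'
      exact (hfm _).sub (this.measurable.comp measurable_snd)
    · simp only [hh, hi, if_false]; exact measurable_const
  have hhb : ∀ i, ∃ C, ∀ p, |h i p| ≤ C := by
    intro i
    refine ⟨c (i+1) + c (i+1), fun p => ?_⟩
    by_cases hi : 2 ≤ i
    · simp only [hh, hi, if_true]
      exact (abs_sub _ _).trans (add_le_add (hfc _ _) (hfIb _ _))
    · simp only [hh, hi, if_false, abs_zero]; linarith [hc0 (i+1)]
  have hh0 : ∀ i y, ∫ g, h i (g, y) ∂μ = 0 := by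
    intro i y
    by_cases hi : 2 ≤ i
    · simp only [hh, hi, if_true]
      rw [integral_sub (hfint _ _) (integrable_const _)]
      simp
    · simp [hh, hi]
  have hhM : ∀ i y, ∫ g, (h i (g, y)) ^ 2 ∂μ ≤ M := by
    intro i y
    by_cases hi : 2 ≤ i
    · simp only [hh, hi, if_true]
      have hsm := (hfint (i+1) y).aestronglyMeasurable
      have h1 := ProbabilityTheory.variance_le_expectation_sq hsm
      rw [ProbabilityTheory.variance_eq_integral hsm.aemeasurable] at h1
      refine h1.trans ?_
      refine integral_mono_of_nonneg (ae_of_all _ fun g => ?_) hmom2 (ae_of_all _ fun g => ?_)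
      · simp only [Pi.pow_apply, Pi.zero_apply]; positivity
      · simp only [Pi.pow_apply]
        rw [← sq_abs]
        exact pow_le_pow_left₀ (abs_nonneg _) (hfN _ _) 2
    · simp [hh, hi, hM0]
  have hbA : ∀ᵐ b ∂β, ∀ i, b i ∈ A := by
    rw [ae_all_iff]
    intro i
    have hmap : β.map (fun b : ℕ → G => b i) = μ := by
      have h1 := congrArg (Measure.map Prod.fst) (aux_map μ β hβ i)
      have hr : Measurable (fun b : ℕ → G => (b i, fun j : Fin i => b j)) :=
        (measurable_pi_apply i).prodMk (measurable_pi_iff.2 fun i => measurable_pi_apply _)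
      rw [Measure.map_map measurable_fst hr, Measure.map_fst_prod] at h1
      simpa [Function.comp_def] using h1
    rw [← hmap] at hAae
    exact ae_of_ae_map (measurable_pi_apply i).aemeasurable hAae
  have hsum : ∀ x : X, ∀ k n : ℕ, k ≤ n → ∀ b : ℕ → G, (∀ i, b i ∈ A) →
      truncSum σ N μ α x n b - truncSum σ N μ α x k b = auxT h x k n b := by
    intro x k n hkn b hb
    induction n, hkn using Nat.le_induction with
    | base => simp [auxT]
    | succ n hkn ih =>
      have e1 : auxT h x k (n+1) b = auxT h x k n b + h n (b n, prodRev b n • x) := by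
        unfold auxT; rw [Finset.sum_Ico_succ_top hkn]
      have e2 : truncSum σ N μ α x (n+1) b
          = truncSum σ N μ α x n b + h n (b n, prodRev b n • x) := by
        unfold truncSum
        by_cases hn : 2 ≤ n
        · rw [Finset.sum_Icc_succ_top (by omega)]
          simp only [Nat.add_sub_cancel, hh, hn, if_true, truncIncC, hfI, hft _ _ _ (hb n)]
        · rw [Finset.Icc_eq_empty (by omega), Finset.Icc_eq_empty (by omega)]
          simp [hh, hn]
      rw [e1, e2, ← ih]; ring
  have htend : Tendsto (fun n : ℕ => Real.log (Real.log n)) atTop atTop :=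
    Real.tendsto_log_atTop.comp (Real.tendsto_log_atTop.comp tendsto_natCast_atTop_atTop)
  obtain ⟨n₁, hn₁⟩ := eventually_atTop.1 (htend.eventually_ge_atTop (M / ε ^ 2 + 1))
  refine ⟨max 3 n₁, le_max_left _ _, ?_⟩
  intro n hn x k hkn
  have hn3 : 3 ≤ n := (le_max_left _ _).trans hn
  have hL := hn₁ n ((le_max_right _ _).trans hn)
  have hL0 : 0 < Real.log (Real.log n) := by
    have : 0 ≤ M / ε ^ 2 := by positivity
    linarith
  have hnpos : (0:ℝ) < n := by exact_mod_cast (by omega : 0 < n)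
  have ha : 0 < ε * lilNorm n := by unfold lilNorm; positivity
  have hna : n * M ≤ (ε * lilNorm n) ^ 2 / 2 := by
    rw [mul_pow, lilNorm, Real.sq_sqrt (by positivity)]
    have h1 : M / ε ^ 2 ≤ Real.log (Real.log n) := by linarith
    rw [div_le_iff₀ (by positivity)] at h1
    nlinarith
  have hfin := aux_main hact μ β hβ h hhm hhb hh0 M hM0 hhM x k n hkn _ ha hna
  have hce : (Set.indicator
            {b2 | |truncSum σ N μ α x n b2 - truncSum σ N μ α x k b2| ≤ ε * lilNorm n}
            (fun _ => (1 : ℝ))) =ᵐ[β]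
      Set.indicator {b2 | |auxT h x k n b2| ≤ ε * lilNorm n} (fun _ => (1 : ℝ)) := by
    filter_upwards [hbA] with b hb
    simp only [Set.indicator, Set.mem_setOf_eq, hsum x k n hkn b hb]
  filter_upwards [hfin, condExp_congr_ae (m := coordSA G k) hce] with b h1 h2
  rw [h2]; exact h1
end
end

section
/- Assume d = 1, μ has finite second moment, and σ is X-controlled. Fix α > 0 and, for x ∈ X, let S_n(b,x) = Σ_{j=3}^{n} X^{(j)}(b_j, b_{j−1}⋯b_1·x) denote the truncated recentered sums with truncation parameter α, and set S_n*(b,x) = max_{k≤n} S_k(b,x). Then for every ε > 0 there exists n₀ ≥ 3 such that for every c > 0, every n ≥ n₀ and every x ∈ X, β{b : S_n*(b,x) ≥ (c+ε) a_n} ≤ 2 β{b : |S_n(b,x)| ≥ c a_n}, where a_n = √(2 n log log n). -/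
open MeasureTheory Filter Topology
open scoped ENNReal NNReal

noncomputable section

section helpers

variable {G : Type*} [Group G] [MeasurableSpace G] [MeasurableMul₂ G]

/-- Keep the first k coordinates, replace the others by 1. -/
def keepFirst {G : Type*} [Group G] (k : ℕ) (b : ℕ → G) : ℕ → G :=
  fun i => if i < k then b i else 1

theorem measurable_prodRev (n : ℕ) : Measurable (fun b : ℕ → G => prodRev b n) := by
  induction n with
  | zero => exact measurable_const
  | succ n ih => exact (measurable_pi_apply n).mul ih

theorem prodRev_congr {b b' : ℕ → G} (n : ℕ) (h : ∀ i < n, b i = b' i) :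
    prodRev b n = prodRev b' n := by
  induction n with
  | zero => rfl
  | succ n ih =>
    simp only [prodRev]
    rw [h n (Nat.lt_succ_self n), ih (fun i hi => h i (by omega))]

theorem law_keepFirst (μ : Measure G) [IsProbabilityMeasure μ]
    (β : Measure (ℕ → G)) [IsProbabilityMeasure β]
    (hβ : ∀ n : ℕ, β.map (fun b (i : Fin n) => b i) = Measure.pi fun _ : Fin n => μ) (k : ℕ) :
    β.map (fun b => (keepFirst k b, b k)) = (β.map (keepFirst k)).prod μ := by
  let E : (Fin k → G) → (ℕ → G) := fun a i => if h : i < k then a ⟨i, h⟩ else 1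
  have hE : Measurable E := by
    refine measurable_pi_lambda _ fun i => ?_
    by_cases h : i < k
    · simp only [E, h, dif_pos]; exact measurable_pi_apply _
    · simp only [E, h, dif_neg, not_false_eq_true]; exact measurable_const
  have hr : ∀ m, Measurable (fun (b : ℕ → G) (i : Fin m) => b i) := fun m =>
    measurable_pi_lambda _ fun i => measurable_pi_apply _
  have h1 : (keepFirst k : (ℕ → G) → _) = E ∘ (fun b (i : Fin k) => b i) := by
    funext b i
    simp only [keepFirst, E, Function.comp]
    split_ifs <;> rfl
  have hp := (measurePreserving_piFinSuccAbove (fun _ : Fin (k+1) => μ) (Fin.last k))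
  let e := MeasurableEquiv.piFinSuccAbove (fun _ : Fin (k+1) => G) (Fin.last k)
  have h2 : (fun b : ℕ → G => (keepFirst k b, b k)) =
      (fun p : G × (Fin k → G) => (E p.2, p.1)) ∘ (e ∘ (fun b (i : Fin (k+1)) => b i)) := by
    funext b
    rw [h1]
    simp [e, MeasurableEquiv.piFinSuccAbove, Fin.insertNthEquiv]
    rfl
  have hm2 : Measurable (fun p : G × (Fin k → G) => (E p.2, p.1)) :=
    (hE.comp measurable_snd).prodMk measurable_fst
  rw [h2, ← Measure.map_map hm2 (e.measurable.comp (hr _)), ← Measure.map_map e.measurable (hr _),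
    hβ, hp.map_eq, h1, ← Measure.map_map hE (hr _), hβ]
  have : (fun p : G × (Fin k → G) => (E p.2, p.1)) = (Prod.map E id) ∘ Prod.swap := rfl
  rw [this, ← Measure.map_map (hE.prodMap measurable_id) measurable_swap, Measure.prod_swap,
    ← Measure.map_prod_map _ _ hE measurable_id, Measure.map_id]

theorem measurable_keepFirst (k : ℕ) : Measurable (keepFirst k : (ℕ → G) → _) := by
  refine measurable_pi_lambda _ fun i => ?_
  by_cases h : i < k
  · simp only [keepFirst, h, if_pos]; exact measurable_pi_apply _
  · simp only [keepFirst, h, if_neg, not_false_eq_true]; exact measurable_const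

theorem lintegral_step (μ : Measure G) [IsProbabilityMeasure μ]
    (β : Measure (ℕ → G)) [IsProbabilityMeasure β]
    (hβ : ∀ n : ℕ, β.map (fun b (i : Fin n) => b i) = Measure.pi fun _ : Fin n => μ) (k : ℕ)
    (H : (ℕ → G) → G → ℝ≥0∞) (hH : Measurable (fun p : (ℕ → G) × G => H p.1 p.2))
    (hk : ∀ b g, H (keepFirst k b) g = H b g) :
    ∫⁻ b, H b (b k) ∂β = ∫⁻ b, ∫⁻ g, H b g ∂μ ∂β := by
  have hm := measurable_keepFirst (G := G) k
  calc ∫⁻ b, H b (b k) ∂β = ∫⁻ b, H (keepFirst k b) (b k) ∂β := by simp only [hk]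
    _ = ∫⁻ p, H p.1 p.2 ∂(β.map (fun b => (keepFirst k b, b k))) := by
        rw [lintegral_map hH (hm.prodMk (measurable_pi_apply k))]
    _ = ∫⁻ b, ∫⁻ g, H b g ∂μ ∂(β.map (keepFirst k)) := by
        rw [law_keepFirst μ β hβ k, lintegral_prod _ hH.aemeasurable]
    _ = ∫⁻ b, ∫⁻ g, H b g ∂μ ∂β := by
        rw [lintegral_map hH.lintegral_prod_right' hm]
        simp only [hk]

variable {X : Type*} [MeasurableSpace X] [MulAction G X]

/-- Partial sums along the random walk. -/
def walkSum {G X : Type*} [Group G] [MulAction G X] (φ : ℕ → G → X → ℝ) (x : X) (n : ℕ)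
    (b : ℕ → G) : ℝ :=
  ∑ i ∈ Finset.range n, φ i (b i) (prodRev b i • x)

theorem measurable_walkSum (hact : Measurable fun p : G × X => p.1 • p.2)
    (φ : ℕ → G → X → ℝ) (hφ : ∀ i, Measurable fun p : G × X => φ i p.1 p.2) (x : X) (n : ℕ) :
    Measurable (walkSum φ x n) := by
  refine Finset.measurable_sum _ fun i _ => ?_
  exact (hφ i).comp ((measurable_pi_apply i).prodMk
    (hact.comp ((measurable_prodRev i).prodMk measurable_const)))

theorem walkSum_keepFirst (φ : ℕ → G → X → ℝ) (x : X) {n k : ℕ} (h : n ≤ k) (b : ℕ → G) :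
    walkSum φ x n (keepFirst k b) = walkSum φ x n b := by
  have hk : ∀ i < k, keepFirst k b i = b i := fun i hi => by simp [keepFirst, hi]
  refine Finset.sum_congr rfl fun i hi => ?_
  rw [Finset.mem_range] at hi
  rw [hk i (by omega), prodRev_congr i (fun j hj => hk j (by omega))]

theorem inner_bound (μ : Measure G) [IsProbabilityMeasure μ] (f : G → ℝ) (M D : ℝ)
    (hf : MemLp f 2 μ) (h0 : ∫ g, f g ∂μ = 0) (hM : ∫ g, f g ^ 2 ∂μ ≤ M) :
    ∫⁻ g, ENNReal.ofReal ((D + f g) ^ 2) ∂μ ≤ ENNReal.ofReal (D ^ 2) + ENNReal.ofReal M := by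
  have hi : Integrable f μ := hf.integrable (by norm_num)
  have hi2 : Integrable (fun g => f g ^ 2) μ := hf.integrable_sq
  have hM0 : 0 ≤ M := (integral_nonneg fun g => sq_nonneg (f g)).trans hM
  have heq : (fun g => (D + f g) ^ 2) = fun g => (D ^ 2 + (2 * D) * f g) + f g ^ 2 := by
    funext g; ring
  have hA : Integrable (fun g => D ^ 2 + (2 * D) * f g) μ :=
    (integrable_const _).add (hi.const_mul _)
  rw [← ofReal_integral_eq_lintegral_ofReal, ← ENNReal.ofReal_add (sq_nonneg D) hM0]
  · apply ENNReal.ofReal_le_ofReal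
    rw [heq, integral_add hA hi2, integral_add (integrable_const _) (hi.const_mul _),
      integral_const_mul, h0]
    simp
    exact hM
  · rw [heq]; exact hA.add hi2
  · exact Eventually.of_forall fun g => sq_nonneg _

theorem var_bound (hact : Measurable fun p : G × X => p.1 • p.2)
    (μ : Measure G) [IsProbabilityMeasure μ]
    (β : Measure (ℕ → G)) [IsProbabilityMeasure β]
    (hβ : ∀ n : ℕ, β.map (fun b (i : Fin n) => b i) = Measure.pi fun _ : Fin n => μ)
    (φ : ℕ → G → X → ℝ) (hφ : ∀ i, Measurable fun p : G × X => φ i p.1 p.2) (x : X) (M : ℝ)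
    (h2 : ∀ i y, MemLp (fun g => φ i g y) 2 μ) (h0 : ∀ i y, ∫ g, φ i g y ∂μ = 0)
    (hM : ∀ i y, ∫ g, φ i g y ^ 2 ∂μ ≤ M) (k : ℕ)
    (A : Set (ℕ → G)) (hA : MeasurableSet A) (hAk : ∀ m, k ≤ m → ∀ b, keepFirst m b ∈ A ↔ b ∈ A)
    (d : ℕ) :
    ∫⁻ b, A.indicator (fun b => ENNReal.ofReal ((walkSum φ x (k + d) b - walkSum φ x k b) ^ 2)) b ∂β
      ≤ d * ENNReal.ofReal M * β A := by
  induction d with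
  | zero => simp
  | succ d ih =>
    have hW := measurable_walkSum hact φ hφ x
    let D : (ℕ → G) → ℝ := fun b => walkSum φ x (k + d) b - walkSum φ x k b
    have hD : Measurable D := (hW _).sub (hW _)
    let H : (ℕ → G) → G → ℝ≥0∞ := fun b g => A.indicator (fun _ => (1 : ℝ≥0∞)) b *
      ENNReal.ofReal ((D b + φ (k + d) g (prodRev b (k + d) • x)) ^ 2)
    have hH : Measurable (fun p : (ℕ → G) × G => H p.1 p.2) := by
      refine ((measurable_const.indicator hA).comp measurable_fst).mul
        (ENNReal.measurable_ofReal.comp (Measurable.pow_const ?_ 2))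
      refine (hD.comp measurable_fst).add ((hφ (k + d)).comp (measurable_snd.prodMk
        (hact.comp (((measurable_prodRev _).comp measurable_fst).prodMk measurable_const))))
    have hHk : ∀ b g, H (keepFirst (k + d) b) g = H b g := by
      intro b g
      have e1 : A.indicator (fun _ => (1 : ℝ≥0∞)) (keepFirst (k + d) b) =
          A.indicator (fun _ => (1 : ℝ≥0∞)) b := by
        by_cases hb : b ∈ A
        · rw [Set.indicator_of_mem hb, Set.indicator_of_mem ((hAk _ (by omega) b).2 hb)]
        · rw [Set.indicator_of_notMem hb,
            Set.indicator_of_notMem (fun h => hb ((hAk _ (by omega) b).1 h))]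
      have e3 : prodRev (keepFirst (k + d) b) (k + d) = prodRev b (k + d) :=
        prodRev_congr _ (fun i hi => by simp [keepFirst, hi])
      simp only [H, D, e1, e3, walkSum_keepFirst φ x (le_refl (k + d)) b,
        walkSum_keepFirst φ x (show k ≤ k + d by omega) b]
    calc ∫⁻ b, A.indicator (fun b => ENNReal.ofReal
            ((walkSum φ x (k + (d + 1)) b - walkSum φ x k b) ^ 2)) b ∂β
        = ∫⁻ b, H b (b (k + d)) ∂β := by
          refine lintegral_congr fun b => ?_
          have : walkSum φ x (k + (d + 1)) b =
              walkSum φ x (k + d) b + φ (k + d) (b (k + d)) (prodRev b (k + d) • x) := by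
            rw [← add_assoc]; exact Finset.sum_range_succ _ _
          by_cases hb : b ∈ A
          · simp only [H, D, Set.indicator_of_mem hb, one_mul, this]
            congr 2; ring
          · simp only [H, Set.indicator_of_notMem hb, zero_mul]
      _ = ∫⁻ b, ∫⁻ g, H b g ∂μ ∂β := lintegral_step μ β hβ _ H hH hHk
      _ ≤ ∫⁻ b, (A.indicator (fun b => ENNReal.ofReal (D b ^ 2)) b +
            A.indicator (fun _ => ENNReal.ofReal M) b) ∂β := by
          refine lintegral_mono fun b => ?_
          by_cases hb : b ∈ A
          · simp only [H, Set.indicator_of_mem hb, one_mul]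
            exact inner_bound μ _ M (D b) (h2 _ _) (h0 _ _) (hM _ _)
          · simp [H, Set.indicator_of_notMem hb]
      _ ≤ d * ENNReal.ofReal M * β A + ENNReal.ofReal M * β A := by
          rw [lintegral_add_right _ (measurable_const.indicator hA), lintegral_indicator_const hA]
          gcongr
      _ = _ := by push_cast; ring

theorem max_ineq_walk (hact : Measurable fun p : G × X => p.1 • p.2)
    (μ : Measure G) [IsProbabilityMeasure μ]
    (β : Measure (ℕ → G)) [IsProbabilityMeasure β]
    (hβ : ∀ n : ℕ, β.map (fun b (i : Fin n) => b i) = Measure.pi fun _ : Fin n => μ)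
    (φ : ℕ → G → X → ℝ) (hφ : ∀ i, Measurable fun p : G × X => φ i p.1 p.2) (x : X) (M : ℝ)
    (h2 : ∀ i y, MemLp (fun g => φ i g y) 2 μ) (h0 : ∀ i y, ∫ g, φ i g y ∂μ = 0)
    (hM : ∀ i y, ∫ g, φ i g y ^ 2 ∂μ ≤ M) (n : ℕ) (s δ : ℝ) (hδ : 0 < δ)
    (hn : 2 * (n * M) ≤ δ ^ 2) :
    β {b | ∃ k ≤ n, s + δ ≤ walkSum φ x k b} ≤ 2 * β {b | s ≤ |walkSum φ x n b|} := by
  have hW := measurable_walkSum hact φ hφ x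
  let A : ℕ → Set (ℕ → G) := fun k =>
    {b | s + δ ≤ walkSum φ x k b ∧ ∀ i < k, walkSum φ x i b < s + δ}
  have hA : ∀ k, MeasurableSet (A k) := by
    intro k
    refine (measurableSet_le measurable_const (hW k)).inter ?_
    have : {b | ∀ i < k, walkSum φ x i b < s + δ} =
        ⋂ i, ⋂ (_ : i < k), {b | walkSum φ x i b < s + δ} := by ext; simp
    change MeasurableSet {b | ∀ i < k, walkSum φ x i b < s + δ}
    rw [this]
    exact MeasurableSet.iInter fun i => MeasurableSet.iInter fun _ =>
      measurableSet_lt (hW i) measurable_const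
  have hAk : ∀ k m, k ≤ m → ∀ b, keepFirst m b ∈ A k ↔ b ∈ A k := by
    intro k m hkm b
    simp only [A, Set.mem_ofPred_eq]
    rw [walkSum_keepFirst φ x hkm]
    refine and_congr_right fun _ => forall₂_congr fun i hi => ?_
    rw [walkSum_keepFirst φ x (by omega)]
  let C : ℕ → Set (ℕ → G) := fun k => {b | |walkSum φ x n b - walkSum φ x k b| < δ}
  have hC : ∀ k, MeasurableSet (C k) := fun k =>
    measurableSet_lt (((hW n).sub (hW k)).abs) measurable_const
  have hδ2 : ENNReal.ofReal (δ ^ 2) ≠ 0 := by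
    simp only [ne_eq, ENNReal.ofReal_eq_zero, not_le]; positivity
  have key : ∀ k ≤ n, β (A k) ≤ 2 * β (A k ∩ C k) := by
    intro k hk
    obtain ⟨d, rfl⟩ := Nat.exists_eq_add_of_le hk
    have hv := var_bound hact μ β hβ φ hφ x M h2 h0 hM k (A k) (hA k) (hAk k) d
    have hM0 : 0 ≤ M := (integral_nonneg fun g => sq_nonneg (φ 0 g x)).trans (hM 0 x)
    have hbad : ENNReal.ofReal (δ ^ 2) * β (A k \ C k) ≤
        d * ENNReal.ofReal M * β (A k) := by
      refine le_trans ?_ hv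
      rw [← lintegral_indicator_const ((hA k).diff (hC k))]
      refine lintegral_mono fun b => ?_
      by_cases hb : b ∈ A k \ C k
      · rw [Set.indicator_of_mem hb, Set.indicator_of_mem hb.1]
        apply ENNReal.ofReal_le_ofReal
        have := hb.2
        simp only [C, Set.mem_ofPred_eq, not_lt] at this
        rw [← sq_abs (walkSum φ x (k + d) b - _)]
        gcongr
      · rw [Set.indicator_of_notMem hb]; exact zero_le
    have hd : 2 * ((d : ℝ≥0∞) * ENNReal.ofReal M) ≤ ENNReal.ofReal (δ ^ 2) := by
      have : 2 * ((d : ℝ≥0∞) * ENNReal.ofReal M) = ENNReal.ofReal (2 * (d * M)) := by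
        rw [ENNReal.ofReal_mul (by norm_num), ENNReal.ofReal_mul (by positivity)]
        simp
      rw [this]
      apply ENNReal.ofReal_le_ofReal
      refine le_trans ?_ hn
      push_cast
      nlinarith [mul_nonneg (Nat.cast_nonneg (α := ℝ) k) hM0]
    have hhalf : 2 * β (A k \ C k) ≤ β (A k) := by
      rw [← ENNReal.mul_le_mul_iff_right hδ2 ENNReal.ofReal_ne_top]
      calc ENNReal.ofReal (δ ^ 2) * (2 * β (A k \ C k))
          = 2 * (ENNReal.ofReal (δ ^ 2) * β (A k \ C k)) := by ring
        _ ≤ 2 * (d * ENNReal.ofReal M * β (A k)) := by gcongr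
        _ = 2 * (d * ENNReal.ofReal M) * β (A k) := by ring
        _ ≤ _ := by gcongr
    have hsplit : β (A k ∩ C k) + β (A k \ C k) = β (A k) := measure_inter_add_sdiff _ (hC k)
    have hfin : β (A k) ≠ ⊤ := measure_ne_top _ _
    have h3 : β (A k) + β (A k) ≤ 2 * β (A k ∩ C k) + β (A k) := by
      calc β (A k) + β (A k) = 2 * (β (A k ∩ C k) + β (A k \ C k)) := by rw [hsplit]; ring
        _ = 2 * β (A k ∩ C k) + 2 * β (A k \ C k) := by ring
        _ ≤ _ := by gcongr
    exact (ENNReal.add_le_add_iff_right hfin).1 h3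
  have hsub : {b | ∃ k ≤ n, s + δ ≤ walkSum φ x k b} ⊆ ⋃ k ∈ Finset.range (n + 1), A k := by
    classical
    rintro b ⟨k, hk, hb⟩
    have hex : ∃ k, s + δ ≤ walkSum φ x k b := ⟨k, hb⟩
    simp only [Set.mem_iUnion, Finset.mem_range]
    refine ⟨Nat.find hex, ?_, Nat.find_spec hex, fun i hi => not_le.1 (Nat.find_min hex hi)⟩
    have := Nat.find_min' hex hb
    omega
  have hdisj : Set.PairwiseDisjoint (↑(Finset.range (n + 1))) (fun k => A k ∩ C k) := by
    have aux : ∀ i j, i < j → Disjoint (A i ∩ C i) (A j ∩ C j) := by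
      intro i j hij
      rw [Set.disjoint_left]
      rintro b hb1 hb2
      exact absurd hb1.1.1 (not_le.2 (hb2.1.2 i hij))
    intro i _ j _ hij
    rcases lt_or_gt_of_ne hij with h | h
    · exact aux i j h
    · exact (aux j i h).symm
  calc β {b | ∃ k ≤ n, s + δ ≤ walkSum φ x k b}
      ≤ β (⋃ k ∈ Finset.range (n + 1), A k) := measure_mono hsub
    _ ≤ ∑ k ∈ Finset.range (n + 1), β (A k) := measure_biUnion_finset_le _ _
    _ ≤ ∑ k ∈ Finset.range (n + 1), 2 * β (A k ∩ C k) :=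
        Finset.sum_le_sum fun k hk => key k (by rw [Finset.mem_range] at hk; omega)
    _ = 2 * β (⋃ k ∈ Finset.range (n + 1), A k ∩ C k) := by
        rw [← Finset.mul_sum, measure_biUnion_finset hdisj fun k _ => (hA k).inter (hC k)]
    _ ≤ _ := by
        gcongr
        intro b hb
        simp only [Set.mem_iUnion] at hb
        obtain ⟨k, _, hb1, hb2⟩ := hb
        have h1 := hb1.1
        have h2 := (abs_lt.1 (show |walkSum φ x n b - walkSum φ x k b| < δ from hb2)).1
        have h3 : s ≤ walkSum φ x n b := by linarith
        exact h3.trans (le_abs_self _)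

end helpers

/-- maximal inequality for the truncated recentered sums. -/
theorem maximal_inequality
    {G : Type*} [Group G] [MeasurableSpace G] [MeasurableMul₂ G]
    {X : Type*} [MetricSpace X] [CompactSpace X] [MeasurableSpace X] [BorelSpace X]
    [MulAction G X] (hact : Measurable fun p : G × X => p.1 • p.2)
    (σ : G → X → ℝ)
    (hσmeas : Measurable fun p : G × X => σ p.1 p.2)
    (hcoc : ∀ g₁ g₂ : G, ∀ x : X, σ (g₂ * g₁) x = σ g₂ (g₁ • x) + σ g₁ x)
    (N : G → ℝ) (hN0 : ∀ g, 0 ≤ N g) (hNsub : ∀ g h : G, N (g * h) ≤ N g + N h)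
    (hNσ : ∀ g x, |σ g x| ≤ N g)
    (μ : Measure G) [IsProbabilityMeasure μ]
    (hmom1 : Integrable N μ)
    (hdrift : ∀ x, ∫ g, σ g x ∂μ = 0)
    (hmom2 : Integrable (fun g => N g ^ 2) μ)
    (hcont : ∀ g, Continuous (σ g))
    (hXctrl : ∀ ε > (0 : ℝ), ∃ R > (0 : ℝ), ∀ n : ℕ, 1 ≤ n → ∀ x y : X,
      ENNReal.ofReal (1 - ε) ≤ convPow μ n {g | |σ g x - σ g y| ≤ R})
    (β : Measure (ℕ → G)) [IsProbabilityMeasure β]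
    (hβ : ∀ n : ℕ, β.map (fun b (i : Fin n) => b i) = Measure.pi fun _ : Fin n => μ)
    (α : ℝ) (hα : 0 < α) :
    ∀ ε > (0 : ℝ), ∃ n₀ : ℕ, 3 ≤ n₀ ∧ ∀ c : ℝ, 0 < c → ∀ n : ℕ, n₀ ≤ n → ∀ x : X,
      β {b | ∃ k ≤ n, (c + ε) * lilNorm n ≤ truncSum σ N μ α x k b} ≤
        2 * β {b | c * lilNorm n ≤ |truncSum σ N μ α x n b|} := by
  intro ε hε
  obtain ⟨N', hN'm, hN'⟩ : ∃ N' : G → ℝ, Measurable N' ∧ N =ᵐ[μ] N' :=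
    ⟨hmom1.1.mk N, hmom1.1.stronglyMeasurable_mk.measurable, hmom1.1.ae_eq_mk⟩
  set M : ℝ := ∫ g, N g ^ 2 ∂μ with hMdef
  -- facts on the truncated increment with the measurable version
  have hTm : ∀ j, Measurable fun p : G × X => truncInc σ N' α j p.1 p.2 := fun j =>
    Measurable.ite (measurableSet_le (hN'm.comp measurable_fst) measurable_const) hσmeas
      measurable_const
  have hTae : ∀ j y, (fun g => truncInc σ N α j g y) =ᵐ[μ] fun g => truncInc σ N' α j g y := by
    intro j y
    filter_upwards [hN'] with g hg
    simp only [truncInc, hg]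
  have hTle : ∀ j g y, |truncInc σ N α j g y| ≤ N g := by
    intro j g y
    unfold truncInc
    split_ifs
    · exact hNσ g y
    · simpa using hN0 g
  have hTle' : ∀ j y, ∀ᵐ g ∂μ, |truncInc σ N' α j g y| ≤ N g := by
    intro j y
    filter_upwards [hTae j y] with g hg
    rw [← hg]; exact hTle j g y
  have hNL2 : MemLp N 2 μ := (memLp_two_iff_integrable_sq hmom1.1).2 hmom2
  have hTL2 : ∀ j y, MemLp (fun g => truncInc σ N' α j g y) 2 μ := by
    intro j y
    refine hNL2.of_le ((hTm j).comp (measurable_id.prodMk measurable_const)).aestronglyMeasurable ?_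
    filter_upwards [hTle' j y] with g hg
    rw [Real.norm_eq_abs, Real.norm_eq_abs]
    exact hg.trans (le_abs_self _)
  let φ : ℕ → G → X → ℝ := fun i => if 2 ≤ i then truncIncC σ N' μ α (i + 1) else fun _ _ => 0
  have hφpos : ∀ i, 2 ≤ i → φ i = truncIncC σ N' μ α (i + 1) := fun i hi => if_pos hi
  have hφneg : ∀ i, ¬ 2 ≤ i → φ i = fun _ _ => 0 := fun i hi => if_neg hi
  have hM0 : 0 ≤ M := integral_nonneg fun g => sq_nonneg _
  have hφm : ∀ i, Measurable fun p : G × X => φ i p.1 p.2 := by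
    intro i
    by_cases hi : 2 ≤ i
    · rw [hφpos i hi]
      refine (hTm (i + 1)).sub ?_
      have h1 : StronglyMeasurable (fun y : X => ∫ g, truncInc σ N' α (i + 1) g y ∂μ) :=
        StronglyMeasurable.integral_prod_right
          (f := fun (y : X) (g : G) => truncInc σ N' α (i + 1) g y)
          ((hTm (i + 1)).comp measurable_swap).stronglyMeasurable
      exact h1.measurable.comp measurable_snd
    · rw [hφneg i hi]; exact measurable_const
  have hφ2 : ∀ i y, MemLp (fun g => φ i g y) 2 μ := by
    intro i y
    by_cases hi : 2 ≤ i
    · rw [hφpos i hi]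
      exact (hTL2 (i + 1) y).sub (memLp_const _)
    · rw [hφneg i hi]; exact memLp_const _
  have hφ0 : ∀ i y, ∫ g, φ i g y ∂μ = 0 := by
    intro i y
    by_cases hi : 2 ≤ i
    · rw [hφpos i hi]
      simp only [truncIncC]
      rw [integral_sub ((hTL2 (i + 1) y).integrable (by norm_num)) (integrable_const _)]
      simp
    · rw [hφneg i hi]; simp
  have hφM : ∀ i y, ∫ g, φ i g y ^ 2 ∂μ ≤ M := by
    intro i y
    by_cases hi : 2 ≤ i
    · rw [hφpos i hi]
      simp only [truncIncC]
      have hT := hTL2 (i + 1) y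
      set T : G → ℝ := fun g => truncInc σ N' α (i + 1) g y with hTdef
      have hTi : Integrable T μ := hT.integrable (by norm_num)
      set m : ℝ := ∫ g, T g ∂μ with hm
      have hTM : ∫ g, T g ^ 2 ∂μ ≤ M := by
        refine integral_mono_ae hT.integrable_sq hmom2 ?_
        filter_upwards [hTle' (i + 1) y] with g hg
        have : |T g| ≤ N g := hg
        change T g ^ 2 ≤ N g ^ 2
        rw [← sq_abs (T g)]
        gcongr
      have heq : (fun g => (T g - m) ^ 2) = fun g => (T g ^ 2 - (2 * m) * T g) + m ^ 2 := by
        funext g; ring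
      change ∫ g, (T g - m) ^ 2 ∂μ ≤ M
      have hI : Integrable (fun g => T g ^ 2 - (2 * m) * T g) μ :=
        hT.integrable_sq.sub (hTi.const_mul _)
      rw [heq, integral_add hI (integrable_const _),
        integral_sub hT.integrable_sq (hTi.const_mul _), integral_const_mul, ← hm]
      simp
      nlinarith [sq_nonneg m]
    · rw [hφneg i hi]; simpa using hM0
  -- almost sure equality of the two sums
  have hmarg : ∀ i : ℕ, β.map (fun b => b i) = μ := by
    intro i
    have h1 : (fun b : ℕ → G => b i) =
        (fun a : Fin (i + 1) → G => a (Fin.last i)) ∘ (fun b (j : Fin (i + 1)) => b j) := by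
      funext b; simp
    have hr : Measurable (fun (b : ℕ → G) (j : Fin (i + 1)) => b j) :=
      measurable_pi_lambda _ fun j => measurable_pi_apply _
    have he : Measurable (fun a : Fin (i + 1) → G => a (Fin.last i)) := measurable_pi_apply _
    rw [h1, ← Measure.map_map he hr, hβ]
    exact (measurePreserving_eval (fun _ : Fin (i + 1) => μ) (Fin.last i)).map_eq
  have hae : ∀ᵐ b ∂β, ∀ i : ℕ, N (b i) = N' (b i) := by
    rw [ae_all_iff]
    intro i
    have h1 : ∀ᵐ g ∂(β.map (fun b => b i)), N g = N' g := by rw [hmarg i]; exact hN'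
    exact ae_of_ae_map (measurable_pi_apply i).aemeasurable h1
  have hsum : ∀ x, ∀ᵐ b ∂β, ∀ n, truncSum σ N μ α x n b = walkSum φ x n b := by
    intro x
    filter_upwards [hae] with b hb n
    unfold truncSum walkSum
    have hterm : ∀ i, 2 ≤ i → truncIncC σ N μ α (i + 1) (b i) (prodRev b i • x) =
        φ i (b i) (prodRev b i • x) := by
      intro i hi
      rw [hφpos i hi]
      simp only [truncIncC]
      rw [integral_congr_ae (hTae (i + 1) (prodRev b i • x))]
      simp only [truncInc, hb i]
    induction n with
    | zero => simp
    | succ n ih =>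
      rw [Finset.sum_range_succ]
      by_cases hn : 2 ≤ n
      · rw [Finset.sum_Icc_succ_top (by omega), ih, Nat.add_sub_cancel, hterm n hn]
      · rw [hφneg n hn, ← ih, Finset.Icc_eq_empty (by omega), Finset.Icc_eq_empty (by omega)]
        simp
  have hll : Tendsto (fun n : ℕ => Real.log (Real.log n)) atTop atTop :=
    Real.tendsto_log_atTop.comp (Real.tendsto_log_atTop.comp tendsto_natCast_atTop_atTop)
  obtain ⟨n₁, hn₁⟩ := eventually_atTop.1
    ((hll.eventually_ge_atTop (M / ε ^ 2)).and (hll.eventually_gt_atTop 0))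
  refine ⟨max 3 n₁, le_max_left _ _, fun c _ n hn x => ?_⟩
  obtain ⟨hL1, hL0⟩ := hn₁ n ((le_max_right _ _).trans hn)
  have hn3 : 3 ≤ n := (le_max_left _ _).trans hn
  have hnpos : (0 : ℝ) < n := by exact_mod_cast (by omega : 0 < n)
  have ha : 0 < lilNorm n := Real.sqrt_pos.2 (by positivity)
  have ha2 : lilNorm n ^ 2 = 2 * n * Real.log (Real.log n) := Real.sq_sqrt (by positivity)
  have hmain := max_ineq_walk hact μ β hβ φ hφm x M hφ2 hφ0 hφM n (c * lilNorm n) (ε * lilNorm n)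
    (by positivity) (by
      rw [mul_pow, ha2]
      rw [div_le_iff₀ (by positivity)] at hL1
      nlinarith [mul_le_mul_of_nonneg_left hL1 hnpos.le])
  have e1 : β {b | ∃ k ≤ n, (c + ε) * lilNorm n ≤ truncSum σ N μ α x k b} =
      β {b | ∃ k ≤ n, c * lilNorm n + ε * lilNorm n ≤ walkSum φ x k b} := by
    refine measure_congr ?_
    filter_upwards [hsum x] with b hb
    refine propext ?_
    change (∃ k ≤ n, _ ≤ truncSum σ N μ α x k b) ↔ (∃ k ≤ n, _ ≤ walkSum φ x k b)
    simp only [hb, add_mul]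
  have e2 : β {b | c * lilNorm n ≤ |truncSum σ N μ α x n b|} =
      β {b | c * lilNorm n ≤ |walkSum φ x n b|} := by
    refine measure_congr ?_
    filter_upwards [hsum x] with b hb
    refine propext ?_
    change (_ ≤ |truncSum σ N μ α x n b|) ↔ (_ ≤ |walkSum φ x n b|)
    rw [hb]
  rw [e1, e2]
  exact hmain
end
end

section
/- Let α > 0. Then (i) for every ε > 0, sup_{s>0} ∫_{εs}^{∞} (1 − (1 − e^{−αt})^{s³}) dt < ∞; and (ii) (1/s) ∫_{0}^{∞} (1 − (1 − e^{−αt})^{s³}) dt → 0 as s → ∞. -/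
open MeasureTheory Filter Topology
open scoped ENNReal NNReal

noncomputable section

lemma overshoot_pw (α : ℝ) (hα : 0 < α) (s t : ℝ) (hs : 0 < s) (ht : 0 < t) :
    1 - (1 - Real.exp (-α * t)) ^ (s ^ 3 : ℝ) ≤ (s ^ 3 + 1) * Real.exp (-α * t) := by
  have hx0 : 0 < Real.exp (-α * t) := Real.exp_pos _
  have hx1 : Real.exp (-α * t) < 1 := by
    apply Real.exp_lt_one_iff.2
    nlinarith [mul_pos hα ht]
  have hp : 0 < s ^ 3 := by positivity
  generalize Real.exp (-α * t) = x at *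
  generalize s ^ 3 = p at *
  rcases le_total 1 p with h | h
  · have := one_add_mul_self_le_rpow_one_add (s := -x) (by linarith) h
    rw [← sub_eq_add_neg] at this
    nlinarith
  · have := Real.rpow_le_rpow_of_exponent_ge (x := 1 - x) (by linarith) (by linarith) h
    rw [Real.rpow_one] at this
    nlinarith

lemma overshoot_tail (α : ℝ) (hα : 0 < α) (ε s : ℝ) (hε : 0 < ε) (hs : 0 < s) :
    ∫⁻ t in Set.Ioi (ε * s),
        ENNReal.ofReal (1 - (1 - Real.exp (-α * t)) ^ (s ^ 3 : ℝ))
      ≤ ENNReal.ofReal ((6 / (α * ε) ^ 3 + 1) / α) := by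
  have hes : 0 < ε * s := mul_pos hε hs
  calc _ ≤ ∫⁻ t in Set.Ioi (ε * s), ENNReal.ofReal ((s ^ 3 + 1) * Real.exp (-α * t)) := by
        apply setLIntegral_mono' measurableSet_Ioi
        intro t ht
        exact ENNReal.ofReal_le_ofReal (overshoot_pw α hα s t hs (hes.trans ht))
    _ = ENNReal.ofReal (∫ t in Set.Ioi (ε * s), (s ^ 3 + 1) * Real.exp (-α * t)) := by
        rw [ofReal_integral_eq_lintegral_ofReal]
        · exact (integrableOn_exp_mul_Ioi (by linarith) _).const_mul _
        · exact Eventually.of_forall fun t => by positivity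
    _ ≤ _ := by
        apply ENNReal.ofReal_le_ofReal
        rw [integral_const_mul, integral_exp_mul_Ioi (by linarith)]
        rw [neg_div_neg_eq, ← mul_div_assoc]
        apply div_le_div_of_nonneg_right _ hα.le
        have h3 := Real.pow_div_factorial_le_exp (α * (ε * s)) (by positivity) 3
        have h1 : Real.exp (-α * (ε * s)) ≤ 1 := by
          apply Real.exp_le_one_iff.2
          nlinarith [mul_pos hα hes]
        have h4 : s ^ 3 * Real.exp (-α * (ε * s)) ≤ 6 / (α * ε) ^ 3 := by
          rw [neg_mul, Real.exp_neg, ← div_eq_mul_inv, div_le_div_iff₀ (Real.exp_pos _) (by positivity)]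
          norm_num [Nat.factorial] at h3
          nlinarith
        nlinarith

/-- integral estimates for `t ↦ 1 − (1 − e^{−αt})^{s³}`. -/
theorem overshoot_integral_estimates (α : ℝ) (hα : 0 < α) :
    (∀ ε > (0 : ℝ), ∃ M : ℝ≥0∞, M < ⊤ ∧ ∀ s : ℝ, 0 < s →
      ∫⁻ t in Set.Ioi (ε * s),
        ENNReal.ofReal (1 - (1 - Real.exp (-α * t)) ^ (s ^ 3 : ℝ)) ≤ M) ∧
    Tendsto (fun s : ℝ =>
        (∫⁻ t in Set.Ioi (0 : ℝ),
          ENNReal.ofReal (1 - (1 - Real.exp (-α * t)) ^ (s ^ 3 : ℝ))).toReal / s)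
      atTop (𝓝 0) := by
  refine ⟨fun ε hε => ⟨_, ENNReal.ofReal_lt_top, fun s hs => overshoot_tail α hα ε s hε hs⟩, ?_⟩
  have key : ∀ ε > (0 : ℝ), ∀ s > (0 : ℝ), (∫⁻ t in Set.Ioi (0 : ℝ),
          ENNReal.ofReal (1 - (1 - Real.exp (-α * t)) ^ (s ^ 3 : ℝ))).toReal
        ≤ ε * s + (6 / (α * ε) ^ 3 + 1) / α := by
    intro ε hε s hs
    have hes : 0 < ε * s := mul_pos hε hs
    apply ENNReal.toReal_le_of_le_ofReal (by positivity)
    rw [ENNReal.ofReal_add (by positivity) (by positivity),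
      ← Set.Ioc_union_Ioi_eq_Ioi hes.le]
    refine (lintegral_union_le _ _ _).trans (add_le_add ?_ (overshoot_tail α hα ε s hε hs))
    calc _ ≤ ∫⁻ t in Set.Ioc 0 (ε * s), 1 := by
          apply setLIntegral_mono' measurableSet_Ioc
          intro t ht
          rw [ENNReal.ofReal_le_one]
          have : Real.exp (-α * t) ≤ 1 := by
            apply Real.exp_le_one_iff.2
            nlinarith [mul_pos hα ht.1]
          have := Real.rpow_nonneg (sub_nonneg.2 this) (s ^ 3)
          linarith
      _ = _ := by simp
  rw [Metric.tendsto_atTop]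
  intro δ hδ
  have hd : 0 < δ / 2 := by positivity
  set C := (6 / (α * (δ / 2)) ^ 3 + 1) / α with hC
  have hC0 : 0 < C := by positivity
  refine ⟨2 * C / δ + 1, fun s hs => ?_⟩
  have hs0 : 0 < s := lt_of_lt_of_le (by positivity) hs
  have hk := key _ hd s hs0
  rw [Real.dist_eq, sub_zero, abs_of_nonneg (by positivity), div_lt_iff₀ hs0]
  have h2 : 2 * C / δ < s := by linarith
  rw [div_lt_iff₀ hδ] at h2
  linarith
end
end

section
/- Assume d = 1 and that ∫_G e^{α₀|g|} dμ(g) < ∞ for some α₀ > 0. Then for every t ∈ (0, α₀), the quantity C = ∫_G |g|² e^{t|g|} dμ(g) is finite, sup_{y∈X} ∫_G e^{t σ(g,y)} dμ(g) ≤ exp(t² C), and consequently for every ε > 0, every n ≥ 1 and every x ∈ X, β{b ∈ B : σ(b_n⋯b_1, x) > εn} ≤ exp(−(ε − tC) t n). -/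
open MeasureTheory Filter Topology
open scoped ENNReal NNReal

noncomputable section

theorem expo_aux (u : ℝ) : Real.exp u ≤ 1 + u + u ^ 2 * Real.exp |u| := by
  by_cases h : |u| ≤ 1
  · have h1 := (abs_le.1 (Real.abs_exp_sub_one_sub_id_le h)).2
    have h2 : 1 ≤ Real.exp |u| := Real.one_le_exp (abs_nonneg u)
    nlinarith [sq_nonneg u]
  · push Not at h
    rcases le_total 0 u with hu | hu
    · rw [abs_of_nonneg hu] at *
      have : 0 < Real.exp u := Real.exp_pos u
      have h3 : 0 ≤ (u ^ 2 - 1) * Real.exp u := mul_nonneg (by nlinarith) this.le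
      nlinarith
    · rw [abs_of_nonpos hu] at *
      have h1 : Real.exp u ≤ 1 := Real.exp_le_one_iff.2 hu
      have h2 : -u + 1 ≤ Real.exp (-u) := Real.add_one_le_exp _
      nlinarith [sq_nonneg u]

theorem measurable_prodRev_aux {G : Type*} [Group G] [MeasurableSpace G] [MeasurableMul₂ G]
    (n : ℕ) : Measurable fun b : ℕ → G => prodRev b n := by
  induction n with
  | zero => exact measurable_const
  | succ n ih => exact (measurable_pi_apply n).mul ih

theorem prodRev_congr_aux {G : Type*} [Group G] (b c : ℕ → G) (n : ℕ)
    (h : ∀ i < n, b i = c i) : prodRev b n = prodRev c n := by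
  induction n with
  | zero => rfl
  | succ n ih =>
    simp only [prodRev]
    rw [h n (by omega), ih fun i hi => h i (by omega)]

/-- Product of a finite word. -/
def finProd {G : Type*} [Group G] (n : ℕ) (v : Fin n → G) : G :=
  prodRev (fun i => if h : i < n then v ⟨i, h⟩ else 1) n

theorem finProd_eq {G : Type*} [Group G] (n : ℕ) (b : ℕ → G) :
    finProd n (fun i : Fin n => b i) = prodRev b n := by
  apply prodRev_congr_aux
  intro i hi
  simp [hi]

theorem measurable_finProd {G : Type*} [Group G] [MeasurableSpace G] [MeasurableMul₂ G]
    (n : ℕ) : Measurable (finProd (G := G) n) := by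
  refine (measurable_prodRev_aux n).comp (measurable_pi_iff.2 fun i => ?_)
  by_cases h : i < n
  · simp only [h, dite_true]; exact measurable_pi_apply _
  · simp only [h, dite_false]; exact measurable_const

theorem map_pair_aux {G : Type*} [MeasurableSpace G] (μ : Measure G) [IsProbabilityMeasure μ]
    (β : Measure (ℕ → G))
    (hβ : ∀ n : ℕ, β.map (fun b (i : Fin n) => b i) = Measure.pi fun _ : Fin n => μ) (n : ℕ) :
    β.map (fun b => ((b n, fun i : Fin n => b i) : G × (Fin n → G))) =
      μ.prod (Measure.pi fun _ : Fin n => μ) := by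
  have h := (measurePreserving_piFinSuccAbove (fun _ : Fin (n + 1) => μ) (Fin.last n)).map_eq
  have hm : Measurable fun (b : ℕ → G) (i : Fin (n + 1)) => b i :=
    measurable_pi_iff.2 fun i => measurable_pi_apply _
  rw [← hβ (n + 1), Measure.map_map (MeasurableEquiv.measurable _) hm] at h
  rw [← h]
  congr 1
  ext b i <;> simp [MeasurableEquiv.piFinSuccAbove, Fin.init]

/-- exponential Chebyshev bound for the cocycle. -/
theorem exponential_chebyshev
    {G : Type*} [Group G] [MeasurableSpace G] [MeasurableMul₂ G]
    {X : Type*} [MetricSpace X] [CompactSpace X] [MeasurableSpace X] [BorelSpace X]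
    [MulAction G X] (hact : Measurable fun p : G × X => p.1 • p.2)
    (σ : G → X → ℝ)
    (hσmeas : Measurable fun p : G × X => σ p.1 p.2)
    (hcoc : ∀ g₁ g₂ : G, ∀ x : X, σ (g₂ * g₁) x = σ g₂ (g₁ • x) + σ g₁ x)
    (N : G → ℝ) (hN0 : ∀ g, 0 ≤ N g) (hNsub : ∀ g h : G, N (g * h) ≤ N g + N h)
    (hNσ : ∀ g x, |σ g x| ≤ N g)
    (μ : Measure G) [IsProbabilityMeasure μ]
    (hmom1 : Integrable N μ)
    (hdrift : ∀ x, ∫ g, σ g x ∂μ = 0)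
    (α₀ : ℝ) (hα₀ : 0 < α₀)
    (hexp : Integrable (fun g => Real.exp (α₀ * N g)) μ)
    (β : Measure (ℕ → G)) [IsProbabilityMeasure β]
    (hβ : ∀ n : ℕ, β.map (fun b (i : Fin n) => b i) = Measure.pi fun _ : Fin n => μ) :
    ∀ t : ℝ, 0 < t → t < α₀ →
      Integrable (fun g => N g ^ 2 * Real.exp (t * N g)) μ ∧
      (∀ y : X, ∫ g, Real.exp (t * σ g y) ∂μ ≤
        Real.exp (t ^ 2 * ∫ g, N g ^ 2 * Real.exp (t * N g) ∂μ)) ∧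
      ∀ ε : ℝ, 0 < ε → ∀ n : ℕ, 1 ≤ n → ∀ x : X,
        β {b | ε * n < σ (prodRev b n) x} ≤
          ENNReal.ofReal
            (Real.exp (-(ε - t * ∫ g, N g ^ 2 * Real.exp (t * N g) ∂μ) * t * n)) := by
  intro t ht htα
  have hNm := hmom1.aestronglyMeasurable
  have hint : Integrable (fun g => N g ^ 2 * Real.exp (t * N g)) μ := by
    refine (hexp.const_mul (2 / (α₀ - t) ^ 2)).mono' ?_ (ae_of_all _ fun g => ?_)
    · exact (hNm.pow 2).mul (Real.continuous_exp.comp_aestronglyMeasurable (hNm.const_mul t))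
    · have hs : 0 < α₀ - t := sub_pos.2 htα
      have hq := Real.quadratic_le_exp_of_nonneg (mul_nonneg hs.le (hN0 g))
      have hsn := mul_nonneg hs.le (hN0 g)
      have e : Real.exp (α₀ * N g) = Real.exp ((α₀ - t) * N g) * Real.exp (t * N g) := by
        rw [← Real.exp_add]; ring_nf
      rw [Real.norm_of_nonneg (by positivity), e, ← mul_assoc]
      gcongr
      rw [div_mul_eq_mul_div, le_div_iff₀ (by positivity)]
      nlinarith
  have hσx : ∀ y, Measurable fun g => σ g y := fun y =>
    hσmeas.comp (measurable_id.prodMk measurable_const)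
  have hσint : ∀ y, Integrable (fun g => σ g y) μ := fun y =>
    hmom1.mono' (hσx y).aestronglyMeasurable (ae_of_all _ fun g => hNσ g y)
  have hpt : ∀ y g, Real.exp (t * σ g y) ≤
      1 + t * σ g y + t ^ 2 * (N g ^ 2 * Real.exp (t * N g)) := by
    intro y g
    refine (expo_aux _).trans ?_
    have h1 : |t * σ g y| ≤ t * N g := by
      rw [abs_mul, abs_of_pos ht]
      exact mul_le_mul_of_nonneg_left (hNσ g y) ht.le
    have h2 : (t * σ g y) ^ 2 ≤ (t * N g) ^ 2 := by
      rw [← sq_abs]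
      gcongr
    have h3 : (t * σ g y) ^ 2 * Real.exp |t * σ g y| ≤ (t * N g) ^ 2 * Real.exp (t * N g) := by
      gcongr
    have h4 : (t * N g) ^ 2 * Real.exp (t * N g) = t ^ 2 * (N g ^ 2 * Real.exp (t * N g)) := by
      ring
    linarith
  have hrint : ∀ y, Integrable
      (fun g => 1 + t * σ g y + t ^ 2 * (N g ^ 2 * Real.exp (t * N g))) μ := fun y =>
    ((integrable_const 1).add ((hσint y).const_mul t)).add (hint.const_mul _)
  have heint : ∀ y, Integrable (fun g => Real.exp (t * σ g y)) μ := fun y =>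
    (hrint y).mono' (Real.measurable_exp.comp ((hσx y).const_mul t)).aestronglyMeasurable
      (ae_of_all _ fun g => by
        rw [Real.norm_of_nonneg (Real.exp_pos _).le]; exact hpt y g)
  set C := ∫ g, N g ^ 2 * Real.exp (t * N g) ∂μ with hC
  have hsup : ∀ y : X, ∫ g, Real.exp (t * σ g y) ∂μ ≤ Real.exp (t ^ 2 * C) := by
    intro y
    refine (integral_mono (heint y) (hrint y) (hpt y)).trans ?_
    have hi1 : Integrable (fun g => 1 + t * σ g y) μ :=
      (integrable_const 1).add ((hσint y).const_mul t)
    rw [integral_add hi1 (hint.const_mul _),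
      integral_add (integrable_const 1) ((hσint y).const_mul t), integral_const_mul,
      integral_const_mul, hdrift y, ← hC]
    have := Real.add_one_le_exp (t ^ 2 * C)
    simp
    linarith
  refine ⟨hint, hsup, ?_⟩
  intro ε hε n hn x
  have hsupl : ∀ y : X, ∫⁻ g, ENNReal.ofReal (Real.exp (t * σ g y)) ∂μ ≤
      ENNReal.ofReal (Real.exp (t ^ 2 * C)) := by
    intro y
    rw [← ofReal_integral_eq_lintegral_ofReal (heint y)
      (ae_of_all _ fun g => (Real.exp_pos _).le)]
    exact ENNReal.ofReal_le_ofReal (hsup y)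
  have hσ1 : σ 1 x = 0 := by
    have := hcoc 1 1 x
    simp at this
    exact this
  have hpm : ∀ m, Measurable fun b : ℕ → G =>
      ENNReal.ofReal (Real.exp (t * σ (prodRev b m) x)) := fun m =>
    (Real.measurable_exp.comp
      (((hσx x).comp (measurable_prodRev_aux m)).const_mul t)).ennreal_ofReal
  have hmain : ∀ m : ℕ, ∫⁻ b, ENNReal.ofReal (Real.exp (t * σ (prodRev b m) x)) ∂β ≤
      ENNReal.ofReal (Real.exp (t ^ 2 * C)) ^ m := by
    intro m
    induction m with
    | zero => simp [prodRev, hσ1]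
    | succ m ih =>
      let f1 : G × (Fin m → G) → ℝ≥0∞ := fun p =>
        ENNReal.ofReal (Real.exp (t * σ p.1 (finProd m p.2 • x)))
      let f2 : (Fin m → G) → ℝ≥0∞ := fun v =>
        ENNReal.ofReal (Real.exp (t * σ (finProd m v) x))
      have hf1 : Measurable f1 := by
        have ha : Measurable fun p : G × (Fin m → G) => finProd m p.2 • x :=
          hact.comp (((measurable_finProd m).comp measurable_snd).prodMk measurable_const)
        have hb : Measurable fun p : G × (Fin m → G) => σ p.1 (finProd m p.2 • x) :=
          hσmeas.comp (measurable_fst.prodMk ha)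
        exact (Real.measurable_exp.comp (hb.const_mul t)).ennreal_ofReal
      have hf2 : Measurable f2 :=
        (Real.measurable_exp.comp
          (((hσx x).comp (measurable_finProd m)).const_mul t)).ennreal_ofReal
      have hf12 : Measurable fun p : G × (Fin m → G) => f1 p * f2 p.2 :=
        hf1.mul (hf2.comp measurable_snd)
      have hrm : ∀ m : ℕ, Measurable fun (b : ℕ → G) (i : Fin m) => b i := fun m =>
        measurable_pi_iff.2 fun i => measurable_pi_apply _
      have hpair : Measurable
          (fun b : ℕ → G => ((b m, fun i : Fin m => b i) : G × (Fin m → G))) :=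
        (measurable_pi_apply m).prodMk (hrm m)
      have e1 : ∫⁻ b, ENNReal.ofReal (Real.exp (t * σ (prodRev b (m + 1)) x)) ∂β =
          ∫⁻ p, f1 p * f2 p.2 ∂(μ.prod (Measure.pi fun _ : Fin m => μ)) := by
        rw [← map_pair_aux μ β hβ m, lintegral_map hf12 hpair]
        refine lintegral_congr fun b => ?_
        simp only [f1, f2, finProd_eq, prodRev]
        rw [← ENNReal.ofReal_mul (Real.exp_pos _).le, ← Real.exp_add, hcoc, mul_add]
      have e2 : ∫⁻ v, f2 v ∂(Measure.pi fun _ : Fin m => μ) =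
          ∫⁻ b, ENNReal.ofReal (Real.exp (t * σ (prodRev b m) x)) ∂β := by
        rw [← hβ m, lintegral_map hf2 (hrm m)]
        simp only [f2, finProd_eq]
      rw [e1, lintegral_prod_symm' _ hf12, pow_succ']
      calc _ ≤ ∫⁻ v, ENNReal.ofReal (Real.exp (t ^ 2 * C)) * f2 v
              ∂(Measure.pi fun _ : Fin m => μ) := by
            refine lintegral_mono fun v => ?_
            simp only
            have hs : Measurable fun g : G => f1 (g, v) :=
              hf1.comp (measurable_id.prodMk measurable_const)
            rw [lintegral_mul_const _ hs]
            gcongr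
            exact hsupl (finProd m v • x)
        _ = ENNReal.ofReal (Real.exp (t ^ 2 * C)) *
              ∫⁻ v, f2 v ∂(Measure.pi fun _ : Fin m => μ) := lintegral_const_mul _ hf2
        _ ≤ _ := by
            rw [e2]
            gcongr
  have hmk := mul_meas_ge_le_lintegral (μ := β) (hpm n)
    (ENNReal.ofReal (Real.exp (t * (ε * n))))
  have hsub : β {b | ε * n < σ (prodRev b n) x} ≤
      β {b | ENNReal.ofReal (Real.exp (t * (ε * n))) ≤
        ENNReal.ofReal (Real.exp (t * σ (prodRev b n) x))} := by
    refine measure_mono fun b hb => ?_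
    have hb' : ε * n < σ (prodRev b n) x := hb
    refine ENNReal.ofReal_le_ofReal (Real.exp_le_exp.2 ?_)
    exact mul_le_mul_of_nonneg_left hb'.le ht.le
  have hfin : ENNReal.ofReal (Real.exp (t * (ε * n))) * β {b | ε * n < σ (prodRev b n) x} ≤
      ENNReal.ofReal (Real.exp (t ^ 2 * C)) ^ n :=
    (mul_le_mul_right hsub _).trans (hmk.trans (hmain n))
  have hK : ENNReal.ofReal (Real.exp (t ^ 2 * C)) ^ n =
      ENNReal.ofReal (Real.exp (t * (ε * n))) *
        ENNReal.ofReal (Real.exp (-(ε - t * C) * t * n)) := by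
    rw [← ENNReal.ofReal_pow (Real.exp_pos _).le, ← ENNReal.ofReal_mul (Real.exp_pos _).le,
      ← Real.exp_nat_mul, ← Real.exp_add]
    congr 2
    ring
  rw [hK] at hfin
  exact (ENNReal.mul_le_mul_iff_right
    (by simpa using Real.exp_pos _) ENNReal.ofReal_ne_top).1 hfin
end
end
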